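/- arXiv:1905.00820 — 4 statements merged into one kernel-verified Lean document; each statement's English description precedes it below -/
import Mathlib

section
/- The pair (θ*, x0*) is a global minimizer of the single-shooting cost V(θ, x0) over Θ × E if and only if there exist x0^2, …, x0^M ∈ E such that (θ*, x0*, x0^2, …, x0^M) is a global minimizer of the multiple-shooting cost V^M(θ, x0^1, …, x0^M) over the feasible set of points in Θ × E^M satisfying the constraints x^{i-1}[m_i] = x0^i for i = 2, 3, …, M. -/
/-- State trajectory started at time `start` from state `x0` with parameter `θ`:
`msTraj h θ start x0 j` is the state at time `start + j`, where
`x[start] = x0` and `x[k] = h k (x[k-1], θ)` for `k > start`. -/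
noncomputable def msTraj {E Θ : Type*} (h : ℕ → E → Θ → E) (θ : Θ)
    (start : ℕ) (x0 : E) : ℕ → E
  | 0 => x0
  | j + 1 => h (start + j + 1) (msTraj h θ start x0 j) θ

/-- The single-shooting cost `V(θ, x0)`. -/
noncomputable def ssCost {E Θ Y : Type*} [NormedAddCommGroup Y]
    (h : ℕ → E → Θ → E) (g : ℕ → E → Θ → Y) (y : ℕ → Y) (N : ℕ)
    (θ : Θ) (x0 : E) : ℝ :=
  (1 / (N : ℝ)) * ∑ k ∈ Finset.Icc 1 N, ‖y k - g k (msTraj h θ 0 x0 k) θ‖ ^ 2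

/-- The multiple-shooting cost `V^M(θ, x0^1, …, x0^M)` with breakpoints `m`. -/
noncomputable def msCost {E Θ Y : Type*} [NormedAddCommGroup Y]
    (h : ℕ → E → Θ → E) (g : ℕ → E → Θ → Y) (y : ℕ → Y) (N M : ℕ) (m : ℕ → ℕ)
    (θ : Θ) (xv : ℕ → E) : ℝ :=
  ∑ i ∈ Finset.Icc 1 M, ((m (i + 1) - m i : ℕ) : ℝ) / (N : ℝ) *
    ((1 / ((m (i + 1) - m i : ℕ) : ℝ)) *
      ∑ k ∈ Finset.Ioc (m i) (m (i + 1)),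
        ‖y k - g k (msTraj h θ (m i) (xv i) (k - m i)) θ‖ ^ 2)

/-- The multiple-shooting feasibility constraints `x^{i-1}[m_i] = x0^i`, `i = 2,…,M`. -/
def msFeasible {E Θ : Type*} (h : ℕ → E → Θ → E) (M : ℕ) (m : ℕ → ℕ)
    (θ : Θ) (xv : ℕ → E) : Prop :=
  ∀ i ∈ Finset.Icc 2 M, msTraj h θ (m (i - 1)) (xv (i - 1)) (m i - m (i - 1)) = xv i

theorem msTraj_add {E Θ : Type*} (h : ℕ → E → Θ → E) (θ : Θ) (start : ℕ) (x0 : E) (a b : ℕ) :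
    msTraj h θ start x0 (a + b) = msTraj h θ (start + a) (msTraj h θ start x0 a) b := by
  induction b with
  | zero => rfl
  | succ b ih =>
    rw [← Nat.add_assoc, msTraj, msTraj, ih]
    simp only [Nat.add_assoc]

theorem msTraj_restart {E Θ : Type*} (h : ℕ → E → Θ → E) (θ : Θ) (x0 : E) {a b : ℕ}
    (hab : a ≤ b) : msTraj h θ a (msTraj h θ 0 x0 a) (b - a) = msTraj h θ 0 x0 b := by
  have key := msTraj_add h θ 0 x0 a (b - a)
  rw [Nat.add_sub_cancel' hab, Nat.zero_add] at key
  exact key.symm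

theorem msFeasible_msTraj {E Θ : Type*} (h : ℕ → E → Θ → E) {M : ℕ} {m : ℕ → ℕ}
    (hmono : ∀ i ∈ Finset.Icc 1 M, m i < m (i + 1)) (θ : Θ) (x0 : E) :
    msFeasible h M m θ (fun i => msTraj h θ 0 x0 (m i)) := by
  intro i hi
  obtain ⟨h2, hM⟩ := Finset.mem_Icc.1 hi
  have hlt := hmono (i - 1) (Finset.mem_Icc.2 ⟨by omega, by omega⟩)
  rw [Nat.sub_add_cancel (by omega : 1 ≤ i)] at hlt
  exact msTraj_restart h θ x0 hlt.le

/-- The initial states of a feasible point lie on the single-shooting trajectory. -/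
theorem msFeasible.eq_msTraj {E Θ : Type*} {h : ℕ → E → Θ → E} {M : ℕ} {m : ℕ → ℕ}
    {θ : Θ} {xv : ℕ → E} (hf : msFeasible h M m θ xv) (hm1 : m 1 = 0)
    (hmono : ∀ i ∈ Finset.Icc 1 M, m i < m (i + 1)) {i : ℕ} (h1 : 1 ≤ i) (hi : i ≤ M) :
    xv i = msTraj h θ 0 (xv 1) (m i) := by
  induction i, h1 using Nat.le_induction with
  | base => rw [hm1, msTraj]
  | succ i h1 ih =>
    have hlt := hmono i (Finset.mem_Icc.2 ⟨h1, by omega⟩)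
    have hstep := hf (i + 1) (Finset.mem_Icc.2 ⟨by omega, hi⟩)
    rw [Nat.add_sub_cancel, ih (by omega), msTraj_restart h θ _ hlt.le] at hstep
    exact hstep.symm

theorem sum_Icc_sum_Ioc_consecutive {R : Type*} [AddCommMonoid R] (f : ℕ → R) {m : ℕ → ℕ}
    (M : ℕ) (hmono : ∀ i ∈ Finset.Icc 1 M, m i ≤ m (i + 1)) :
    m 1 ≤ m (M + 1) ∧ ∑ i ∈ Finset.Icc 1 M, ∑ k ∈ Finset.Ioc (m i) (m (i + 1)), f k =
      ∑ k ∈ Finset.Ioc (m 1) (m (M + 1)), f k := by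
  induction M with
  | zero => simp
  | succ M ih =>
    obtain ⟨hle, hsum⟩ := ih fun i hi =>
      hmono i (Finset.Icc_subset_Icc_right (Nat.le_succ M) hi)
    have hlast := hmono (M + 1) (Finset.mem_Icc.2 ⟨by omega, le_rfl⟩)
    refine ⟨hle.trans hlast, ?_⟩
    rw [Finset.sum_Icc_succ_top (by omega), hsum, Finset.sum_Ioc_consecutive f hle hlast]

/-- On the feasible set the multiple-shooting cost equals the single-shooting cost. -/
theorem msFeasible.msCost_eq {E Θ Y : Type*} [NormedAddCommGroup Y]
    {h : ℕ → E → Θ → E} {N M : ℕ} {m : ℕ → ℕ} {θ : Θ} {xv : ℕ → E}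
    (hf : msFeasible h M m θ xv) (g : ℕ → E → Θ → Y) (y : ℕ → Y)
    (hm1 : m 1 = 0) (hmN : m (M + 1) = N)
    (hmono : ∀ i ∈ Finset.Icc 1 M, m i < m (i + 1)) :
    msCost h g y N M m θ xv = ssCost h g y N θ (xv 1) := by
  have hsum := (sum_Icc_sum_Ioc_consecutive
    (fun k => ‖y k - g k (msTraj h θ 0 (xv 1) k) θ‖ ^ 2) M fun i hi => (hmono i hi).le).2
  rw [hm1, hmN] at hsum
  rw [ssCost, show Finset.Icc 1 N = Finset.Ioc 0 N from rfl, ← hsum, Finset.mul_sum, msCost]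
  refine Finset.sum_congr rfl fun i hi => ?_
  obtain ⟨h1, hM⟩ := Finset.mem_Icc.1 hi
  have hΔ : ((m (i + 1) - m i : ℕ) : ℝ) ≠ 0 :=
    Nat.cast_ne_zero.2 (Nat.sub_pos_of_lt (hmono i hi)).ne'
  have hinner : ∀ k ∈ Finset.Ioc (m i) (m (i + 1)),
      ‖y k - g k (msTraj h θ (m i) (xv i) (k - m i)) θ‖ ^ 2 =
        ‖y k - g k (msTraj h θ 0 (xv 1) k) θ‖ ^ 2 := fun k hk => by
    rw [hf.eq_msTraj hm1 hmono h1 hM, msTraj_restart h θ _ (Finset.mem_Ioc.1 hk).1.le]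
  rw [Finset.sum_congr rfl hinner, ← mul_assoc]
  congr 1
  field_simp

/-- Corollary 3 of the paper: `(θ*, x0*)` is a global minimizer of the
single-shooting cost iff there exist `x0^2, …, x0^M` such that
`(θ*, x0*, x0^2, …, x0^M)` is a global minimizer of the multiple-shooting cost
over the feasible set determined by the constraints. -/
theorem single_shooting_global_min_iff_multiple_shooting_global_min
    {E Θ Y : Type*} [NormedAddCommGroup Y]
    (N M : ℕ) (hN : 0 < N) (hM : 0 < M)
    (h : ℕ → E → Θ → E) (g : ℕ → E → Θ → Y) (y : ℕ → Y)
    (m : ℕ → ℕ) (hm1 : m 1 = 0) (hmN : m (M + 1) = N)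
    (hmono : ∀ i ∈ Finset.Icc 1 M, m i < m (i + 1))
    (θs : Θ) (x0s : E) :
    (∀ (θ : Θ) (x0 : E), ssCost h g y N θs x0s ≤ ssCost h g y N θ x0) ↔
      (∃ xv : ℕ → E, xv 1 = x0s ∧ msFeasible h M m θs xv ∧
        ∀ (θ : Θ) (xv' : ℕ → E), msFeasible h M m θ xv' →
          msCost h g y N M m θs xv ≤ msCost h g y N M m θ xv') := by
  constructor
  · intro hmin
    have hf := msFeasible_msTraj h hmono θs x0s
    have hx : msTraj h θs 0 x0s (m 1) = x0s := by rw [hm1, msTraj]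
    refine ⟨_, hx, hf, fun θ xv' hf' => ?_⟩
    rw [hf.msCost_eq g y hm1 hmN hmono, hf'.msCost_eq g y hm1 hmN hmono, hx]
    exact hmin θ _
  · rintro ⟨xv, rfl, hf, hmin⟩ θ x0
    have hf' := msFeasible_msTraj h hmono θ x0
    have hle := hmin θ _ hf'
    rwa [hf.msCost_eq g y hm1 hmN hmono, hf'.msCost_eq g y hm1 hmN hmono, hm1, msTraj] at hle
end

section
/- Suppose each state-transition map h_k : E × Θ → E is Lipschitz in (x, θ) with constant L_h > 0 and each output map g_k : E × Θ → Y is Lipschitz in (x, θ) with constant L_g, i.e. ‖g_k(x, θ) − g_k(w, φ)‖² ≤ L_g²·(‖x − w‖² + ‖θ − φ‖²). Let ŷ[k] = g_k(x[k], θ) and ŷ'[k] = g_k(w[k], φ) be the predictions along the trajectories generated from (x0, θ) and (w0, φ). Then for every k ≥ 1: ‖ŷ[k] − ŷ'[k]‖ ≤ L_g · S(k) · √(‖θ − φ‖² + ‖x0 − w0‖²), where S(k) = √(Σ_{ℓ=0}^{k} L_h^{2ℓ}). -/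
open Finset in
/-- A sequence driven by a growth factor `c` and a constant input `p` is bounded
by a geometric sum. -/
theorem add_le_geom_sum_mul_of_succ_le {a : ℕ → ℝ} {c p : ℝ} (hc : 0 ≤ c) (ha : 0 ≤ a 0)
    (hstep : ∀ k, a (k + 1) ≤ c * (a k + p)) (k : ℕ) :
    a k + p ≤ (∑ ℓ ∈ range (k + 1), c ^ ℓ) * (p + a 0) := by
  induction k with
  | zero => simp [add_comm]
  | succ k ih =>
    rw [geom_sum_succ]
    linarith [hstep k, mul_le_mul_of_nonneg_left ih hc]

open Finset in
/-- Inequality (13) in the proof of Theorem 1(a): if each `h_k` is Lipschitz in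
`(x, θ)` with constant `L_h > 0` and each `g_k` is Lipschitz in `(x, θ)` with
constant `L_g`, then the predictions along two trajectories satisfy
`‖ŷ[k] − ŷ'[k]‖ ≤ L_g · S(k) · √(‖θ − φ‖² + ‖x0 − w0‖²)` for `k ≥ 1`, where
`S(k) = √(Σ_{ℓ=0}^{k} L_h^{2ℓ})`. -/
theorem prediction_divergence_bound
    {E Θ Y : Type*} [NormedAddCommGroup E] [NormedAddCommGroup Θ]
    [NormedAddCommGroup Y]
    (h : ℕ → E → Θ → E) (g : ℕ → E → Θ → Y)
    (Lh Lg : ℝ) (hLh : 0 < Lh) (hLg : 0 ≤ Lg)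
    (hLiph : ∀ (k : ℕ) (x w : E) (θ φ : Θ),
      ‖h k x θ - h k w φ‖ ^ 2 ≤ Lh ^ 2 * (‖x - w‖ ^ 2 + ‖θ - φ‖ ^ 2))
    (hLipg : ∀ (k : ℕ) (x w : E) (θ φ : Θ),
      ‖g k x θ - g k w φ‖ ^ 2 ≤ Lg ^ 2 * (‖x - w‖ ^ 2 + ‖θ - φ‖ ^ 2))
    (θ φ : Θ) (x0 w0 : E) (x w : ℕ → E)
    (hx0 : x 0 = x0) (hw0 : w 0 = w0)
    (hx : ∀ k : ℕ, x (k + 1) = h (k + 1) (x k) θ)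
    (hw : ∀ k : ℕ, w (k + 1) = h (k + 1) (w k) φ) :
    ∀ k : ℕ, 1 ≤ k →
      ‖g k (x k) θ - g k (w k) φ‖ ≤
        Lg * Real.sqrt (∑ ℓ ∈ Finset.range (k + 1), Lh ^ (2 * ℓ)) *
          Real.sqrt (‖θ - φ‖ ^ 2 + ‖x0 - w0‖ ^ 2) := by
  intro k _
  have key := add_le_geom_sum_mul_of_succ_le (a := fun k ↦ ‖x k - w k‖ ^ 2) (c := Lh ^ 2)
    (p := ‖θ - φ‖ ^ 2) (sq_nonneg _) (sq_nonneg _)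
    (fun k ↦ by simpa only [hx, hw] using hLiph (k + 1) (x k) (w k) θ φ) k
  simp only [hx0, hw0, ← pow_mul] at key
  have hS : 0 ≤ ∑ ℓ ∈ range (k + 1), Lh ^ (2 * ℓ) := by positivity
  refine (abs_le_of_sq_le_sq' ?_ (by positivity)).2
  rw [mul_pow, mul_pow, Real.sq_sqrt hS, Real.sq_sqrt (by positivity), mul_assoc]
  exact (hLipg k _ _ θ φ).trans (mul_le_mul_of_nonneg_left key (sq_nonneg _))
end

section
/- Suppose each state-transition map h_k : E × Θ → E is Lipschitz in (x, θ) with constant L_h > 0 and each output map g_k : E × Θ → Y is Lipschitz in (x, θ) with constant L_g. Fix measured outputs y[1], …, y[N] ∈ Y with ‖y[k]‖ ≤ L_y for all k, and fix a set Ω ⊆ Θ × E of parameter/initial-condition pairs such that for every (θ, x0) ∈ Ω the resulting predictions satisfy ‖ŷ[k]‖ ≤ M(k) for all k = 1,…,N, where M(k) ≥ 0. Then the cost function V(θ, x0) = (1/N)·Σ_{k=1}^{N} ‖y[k] − ŷ[k]‖² is Lipschitz on Ω with respect to the norm ‖(θ, x0)‖ = √(‖θ‖² + ‖x0‖²), with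 Lipschitz constant at most L_V = (2·L_g/N)·Σ_{k=1}^{N} (L_y + M(k))·S(k), where S(k) = √(Σ_{ℓ=0}^{k} L_h^{2ℓ}). -/
/-- The state trajectory of the prediction model: `x[0] = x0` and
`x[k] = h_k(x[k-1], θ)`. -/
noncomputable def predTraj {E Θ : Type*} (h : ℕ → E → Θ → E) (θ : Θ) (x0 : E) :
    ℕ → E
  | 0 => x0
  | k + 1 => h (k + 1) (predTraj h θ x0 k) θ

/-- Squared distance of two trajectories, together with the squared parameter distance,
grows at most by the factor `∑ ℓ ≤ k, Lh ^ (2 * ℓ)`. -/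
theorem norm_predTraj_sub_sq_add_le {E Θ : Type*}
    [SeminormedAddCommGroup E] [SeminormedAddCommGroup Θ]
    (h : ℕ → E → Θ → E) (Lh : ℝ)
    (hLip : ∀ (k : ℕ) (x w : E) (θ φ : Θ),
      ‖h k x θ - h k w φ‖ ^ 2 ≤ Lh ^ 2 * (‖x - w‖ ^ 2 + ‖θ - φ‖ ^ 2))
    (θ φ : Θ) (x w : E) (k : ℕ) :
    ‖predTraj h θ x k - predTraj h φ w k‖ ^ 2 + ‖θ - φ‖ ^ 2 ≤
      (∑ ℓ ∈ Finset.range (k + 1), Lh ^ (2 * ℓ)) * (‖θ - φ‖ ^ 2 + ‖x - w‖ ^ 2) := by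
  induction k with
  | zero => simp [predTraj, add_comm]
  | succ k ih =>
    have hsum : ∑ ℓ ∈ Finset.range (k + 1 + 1), Lh ^ (2 * ℓ) =
        Lh ^ 2 * ∑ ℓ ∈ Finset.range (k + 1), Lh ^ (2 * ℓ) + 1 := by
      rw [Finset.sum_range_succ', Finset.mul_sum]
      congr 1
      exact Finset.sum_congr rfl fun ℓ _ => by ring
    have hstep := hLip (k + 1) (predTraj h θ x k) (predTraj h φ w k) θ φ
    have hmul := mul_le_mul_of_nonneg_left ih (sq_nonneg Lh)
    rw [hsum]
    simp only [predTraj]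
    nlinarith [sq_nonneg ‖x - w‖]

theorem abs_norm_sq_sub_norm_sq_le {Y : Type*} [SeminormedAddCommGroup Y] (a b : Y) :
    |‖a‖ ^ 2 - ‖b‖ ^ 2| ≤ (‖a‖ + ‖b‖) * ‖a - b‖ := by
  rw [sq_sub_sq, abs_mul, abs_of_nonneg (by positivity)]
  gcongr
  exact abs_norm_sub_norm_le a b

open Finset in
/-- Theorem 1(a) of the paper, with explicit constant: under Lipschitz
assumptions on `h_k` and `g_k` and boundedness of the predictions on
`Ω ⊆ Θ × E`, the prediction-error cost `V(θ, x0)` is Lipschitz on `Ω`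
(w.r.t. the norm `√(‖θ‖² + ‖x0‖²)`) with constant at most
`L_V = (2·L_g/N)·Σ_{k=1}^{N} (L_y + M(k))·S(k)`, where
`S(k) = √(Σ_{ℓ=0}^{k} L_h^{2ℓ})`. -/
theorem cost_function_lipschitz
    {E Θ Y : Type*}
    [NormedAddCommGroup E] [InnerProductSpace ℝ E]
    [NormedAddCommGroup Θ] [InnerProductSpace ℝ Θ]
    [NormedAddCommGroup Y] [InnerProductSpace ℝ Y]
    (N : ℕ) (hN : 0 < N)
    (h : ℕ → E → Θ → E) (g : ℕ → E → Θ → Y)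
    (Lh Lg : ℝ) (hLh : 0 < Lh) (hLg : 0 ≤ Lg)
    (hLiph : ∀ (k : ℕ) (x w : E) (θ φ : Θ),
      ‖h k x θ - h k w φ‖ ^ 2 ≤ Lh ^ 2 * (‖x - w‖ ^ 2 + ‖θ - φ‖ ^ 2))
    (hLipg : ∀ (k : ℕ) (x w : E) (θ φ : Θ),
      ‖g k x θ - g k w φ‖ ^ 2 ≤ Lg ^ 2 * (‖x - w‖ ^ 2 + ‖θ - φ‖ ^ 2))
    (y : ℕ → Y) (Ly : ℝ) (hy : ∀ k ∈ Finset.Icc 1 N, ‖y k‖ ≤ Ly)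
    (Ω : Set (Θ × E)) (M : ℕ → ℝ) (hM : ∀ k ∈ Finset.Icc 1 N, 0 ≤ M k)
    (hbound : ∀ p ∈ Ω, ∀ k ∈ Finset.Icc 1 N,
      ‖g k (predTraj h p.1 p.2 k) p.1‖ ≤ M k) :
    ∀ p ∈ Ω, ∀ q ∈ Ω,
      |(1 / (N : ℝ)) * ∑ k ∈ Finset.Icc 1 N,
            ‖y k - g k (predTraj h p.1 p.2 k) p.1‖ ^ 2 -
          (1 / (N : ℝ)) * ∑ k ∈ Finset.Icc 1 N,
            ‖y k - g k (predTraj h q.1 q.2 k) q.1‖ ^ 2| ≤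
        ((2 * Lg / (N : ℝ)) * ∑ k ∈ Finset.Icc 1 N, (Ly + M k) *
            Real.sqrt (∑ ℓ ∈ Finset.range (k + 1), Lh ^ (2 * ℓ))) *
          Real.sqrt (‖p.1 - q.1‖ ^ 2 + ‖p.2 - q.2‖ ^ 2) := by
  intro p hp q hq
  have hN' : (0 : ℝ) < N := by exact_mod_cast hN
  set D := Real.sqrt (‖p.1 - q.1‖ ^ 2 + ‖p.2 - q.2‖ ^ 2) with hD
  have hterm : ∀ k ∈ Finset.Icc 1 N,
      |‖y k - g k (predTraj h p.1 p.2 k) p.1‖ ^ 2 -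
        ‖y k - g k (predTraj h q.1 q.2 k) q.1‖ ^ 2| ≤
      (2 * Lg * D) * ((Ly + M k) *
        Real.sqrt (∑ ℓ ∈ Finset.range (k + 1), Lh ^ (2 * ℓ))) := by
    intro k hk
    set S := ∑ ℓ ∈ Finset.range (k + 1), Lh ^ (2 * ℓ)
    have hS : 0 ≤ S := Finset.sum_nonneg fun ℓ _ => by positivity
    set u := g k (predTraj h p.1 p.2 k) p.1
    set v := g k (predTraj h q.1 q.2 k) q.1
    have huv : ‖(y k - u) - (y k - v)‖ ≤ Lg * (Real.sqrt S * D) := by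
      rw [sub_sub_sub_cancel_left, norm_sub_rev]
      refine (sq_le_sq₀ (norm_nonneg _) (by positivity)).1 ?_
      rw [mul_pow, mul_pow, Real.sq_sqrt hS, hD, Real.sq_sqrt (by positivity)]
      exact (hLipg k _ _ _ _).trans (mul_le_mul_of_nonneg_left
        (norm_predTraj_sub_sq_add_le h Lh hLiph p.1 q.1 p.2 q.2 k) (sq_nonneg Lg))
    have hnorm : ‖y k - u‖ + ‖y k - v‖ ≤ 2 * (Ly + M k) := by
      linarith [norm_sub_le (y k) u, norm_sub_le (y k) v, hy k hk,
        hbound p hp k hk, hbound q hq k hk]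
    calc _ ≤ (‖y k - u‖ + ‖y k - v‖) * ‖(y k - u) - (y k - v)‖ :=
          abs_norm_sq_sub_norm_sq_le _ _
      _ ≤ (2 * (Ly + M k)) * (Lg * (Real.sqrt S * D)) :=
          mul_le_mul hnorm huv (norm_nonneg _) (le_trans (by positivity) hnorm)
      _ = _ := by ring
  rw [← mul_sub, ← Finset.sum_sub_distrib, abs_mul, abs_of_pos (by positivity)]
  calc _ ≤ 1 / (N : ℝ) * ∑ k ∈ Finset.Icc 1 N, (2 * Lg * D) * ((Ly + M k) *
        Real.sqrt (∑ ℓ ∈ Finset.range (k + 1), Lh ^ (2 * ℓ))) := by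
        gcongr
        exact (Finset.abs_sum_le_sum_abs _ _).trans (Finset.sum_le_sum hterm)
    _ = _ := by
        rw [← Finset.mul_sum]
        ring
end

section
/- Suppose each state-transition map h_k : E × Θ → E is Lipschitz in (x, θ) with constant L_h > 0, differentiable, and its (total) derivative Dh_k : E × Θ → L(E × Θ, E) is Lipschitz in (x, θ) with constant L'_h, i.e. ‖Dh_k(x, θ) − Dh_k(w, φ)‖ ≤ L'_h·√(‖x − w‖² + ‖θ − φ‖²) in operator norm. Let x[·] and w[·] be the trajectories generated from (x0, θ) and (w0, φ), and let A_k = Dh_k(x[k], θ) and A'_k = Dh_k(w[k], φ). Then for every k ≥ 0: ‖A_k − A'_k‖ ≤ L'_h · S(k) · √(‖x0 − w0‖² + ‖θ − φ‖²), where S(k) = √(Σ_{ℓ=0}^{k} L_h^{2ℓ}). -/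
/-- The square of the `L²` distance between `(x, θ)` and `(w, φ)`. -/
theorem norm_sub_sq_withLp_prod {E Θ : Type*}
    [NormedAddCommGroup E] [NormedAddCommGroup Θ] (x w : E) (θ φ : Θ) :
    ‖(WithLp.equiv 2 (E × Θ)).symm (x, θ) - (WithLp.equiv 2 (E × Θ)).symm (w, φ)‖ ^ 2 =
      ‖x - w‖ ^ 2 + ‖θ - φ‖ ^ 2 := by
  simp [WithLp.prod_norm_sq_eq_of_L2]

/-- A discrete Grönwall bound for the recursion `d (k + 1) ≤ a * (d k + t)`. -/
theorem add_le_geom_sum_mul_of_le_mul_add {d : ℕ → ℝ} {a t : ℝ} (ha : 0 ≤ a) (hd : 0 ≤ d 0)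
    (hrec : ∀ k, d (k + 1) ≤ a * (d k + t)) (k : ℕ) :
    d k + t ≤ (∑ i ∈ Finset.range (k + 1), a ^ i) * (d 0 + t) := by
  induction k with
  | zero => simp
  | succ k ih =>
    rw [geom_sum_succ]
    linarith [hrec k, mul_le_mul_of_nonneg_left ih ha]


open Finset in
/-- Inequality (B.9) in the proof of Theorem 1(b): if each `h_k` is
`L_h`-Lipschitz in `(x, θ)` (the domain `WithLp 2 (E × Θ)` carries exactly the
norm `√(‖x‖² + ‖θ‖²)`), differentiable, and its total derivative is
`L'_h`-Lipschitz, then the Jacobians `A_k = Dh_k(x[k], θ)` and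
`A'_k = Dh_k(w[k], φ)` along two trajectories satisfy
`‖A_k − A'_k‖ ≤ L'_h · S(k) · √(‖x0 − w0‖² + ‖θ − φ‖²)` where
`S(k) = √(Σ_{ℓ=0}^{k} L_h^{2ℓ})`. -/
theorem jacobian_divergence_bound
    {E Θ : Type*}
    [NormedAddCommGroup E] [InnerProductSpace ℝ E]
    [NormedAddCommGroup Θ] [InnerProductSpace ℝ Θ]
    (h : ℕ → WithLp 2 (E × Θ) → E)
    (Lh Lh' : ℝ) (hLh : 0 < Lh) (hLh' : 0 ≤ Lh')
    (hLip : ∀ (k : ℕ) (p q : WithLp 2 (E × Θ)),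
      ‖h k p - h k q‖ ≤ Lh * ‖p - q‖)
    (hdiff : ∀ k : ℕ, Differentiable ℝ (h k))
    (hDLip : ∀ (k : ℕ) (p q : WithLp 2 (E × Θ)),
      ‖fderiv ℝ (h k) p - fderiv ℝ (h k) q‖ ≤ Lh' * ‖p - q‖)
    (θ φ : Θ) (x0 w0 : E) (x w : ℕ → E)
    (hx0 : x 0 = x0) (hw0 : w 0 = w0)
    (hx : ∀ k : ℕ, x (k + 1) = h (k + 1) ((WithLp.equiv 2 (E × Θ)).symm (x k, θ)))
    (hw : ∀ k : ℕ, w (k + 1) = h (k + 1) ((WithLp.equiv 2 (E × Θ)).symm (w k, φ))) :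
    ∀ k : ℕ,
      ‖fderiv ℝ (h k) ((WithLp.equiv 2 (E × Θ)).symm (x k, θ)) -
          fderiv ℝ (h k) ((WithLp.equiv 2 (E × Θ)).symm (w k, φ))‖ ≤
        Lh' * Real.sqrt (∑ ℓ ∈ Finset.range (k + 1), Lh ^ (2 * ℓ)) *
          Real.sqrt (‖x0 - w0‖ ^ 2 + ‖θ - φ‖ ^ 2) := by
  intro k
  have hrec : ∀ k, ‖x (k + 1) - w (k + 1)‖ ^ 2 ≤
      Lh ^ 2 * (‖x k - w k‖ ^ 2 + ‖θ - φ‖ ^ 2) := fun k ↦ by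
    rw [hx, hw, ← norm_sub_sq_withLp_prod, ← mul_pow]
    exact pow_le_pow_left₀ (norm_nonneg _) (hLip _ _ _) 2
  have hdist := add_le_geom_sum_mul_of_le_mul_add (d := fun k ↦ ‖x k - w k‖ ^ 2)
    (sq_nonneg Lh) (sq_nonneg _) hrec k
  simp only [hx0, hw0, ← pow_mul, ← norm_sub_sq_withLp_prod (x k)] at hdist
  rw [mul_assoc, ← Real.sqrt_mul (Finset.sum_nonneg fun ℓ _ ↦ pow_nonneg hLh.le _)]
  exact (hDLip k _ _).trans (mul_le_mul_of_nonneg_left (Real.le_sqrt_of_sq_le hdist) hLh')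
end
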